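/- Let (X,σ) be an infinite minimal one-sided shift and let (X̄,σ̄) be its two-sided version, the set of all bi-infinite sequences over the same alphabet whose finite blocks all lie in the language of X. Then X has finitely many branch points if and only if X̄ has finitely many right asymptotic σ̄-orbits. -/

import Mathlib

/-- The one-sided shift map on `A^ℕ`. -/
def shiftN {A : Type*} (x : ℕ → A) : ℕ → A := fun n => x (n + 1)

/-- The complexity function: the number of words of length `n` occurring in points of `X`. -/
noncomputable def complexityN {A : Type*} [Fintype A] (X : Set (ℕ → A)) (n : ℕ) : ℕ :=
  Nat.card {w : Fin n → A | ∃ x ∈ X, ∃ i : ℕ, ∀ j : Fin n, w j = x (i + (j : ℕ))}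

/-- `X` has sublinear complexity: `p(n) ≤ C n` for all `n ≥ 1`. -/
def SublinearComplexityN {A : Type*} [Fintype A] (X : Set (ℕ → A)) : Prop :=
  ∃ C : ℕ, ∀ n : ℕ, 1 ≤ n → complexityN X n ≤ C * n

/-- Minimality of a one-sided shift: every forward orbit is dense in `X`. -/
def MinimalN {A : Type*} [TopologicalSpace A] (X : Set (ℕ → A)) : Prop :=
  ∀ x ∈ X, X ⊆ closure {y : ℕ → A | ∃ n : ℕ, y = shiftN^[n] x}

/-- The two-sided shift map on `A^ℤ`. -/
def shiftZ {A : Type*} (x : ℤ → A) : ℤ → A := fun n => x (n + 1)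

/-- The `n`-th power of the two-sided shift, `n ∈ ℤ`. -/
def shiftZIter {A : Type*} (n : ℤ) (x : ℤ → A) : ℤ → A := fun m => x (m + n)

/-- The (two-sided) shift orbit of a point. -/
def orbitZ {A : Type*} (x : ℤ → A) : Set (ℤ → A) :=
  Set.range fun n : ℤ => shiftZIter n x

/-- Two points of `A^ℤ` are right asymptotic if they eventually agree to the right. -/
def RightAsymptotic {A : Type*} (x y : ℤ → A) : Prop :=
  ∃ N : ℤ, ∀ n : ℤ, N ≤ n → x n = y n

/-- Two (sets thought of as) orbits contain right asymptotic points. -/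
def OrbitsContainRA {A : Type*} (O O' : Set (ℤ → A)) : Prop :=
  ∃ p ∈ O, ∃ q ∈ O', RightAsymptotic p q

/-- `O` is a right asymptotic orbit of `X`: it is the orbit of a point of `X` and it is
right asymptotic to some orbit of a point of `X` disjoint from it. -/
def IsRAOrbit {A : Type*} (X : Set (ℤ → A)) (O : Set (ℤ → A)) : Prop :=
  (∃ x ∈ X, O = orbitZ x) ∧
    ∃ y ∈ X, O ∩ orbitZ y = ∅ ∧ OrbitsContainRA O (orbitZ y)

/-- `x` is a branch point of `X`: it lies in `X` and has at least two σ-preimages in `X`. -/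
def IsBranchPoint {A : Type*} (X : Set (ℕ → A)) (x : ℕ → A) : Prop :=
  x ∈ X ∧ ∃ y ∈ X, ∃ z ∈ X, y ≠ z ∧ shiftN y = x ∧ shiftN z = x

/-- The two-sided version of the one-sided shift `X`: all bi-infinite sequences all of
whose finite blocks occur in points of `X`. -/
def twoSidedVersion {A : Type*} (X : Set (ℕ → A)) : Set (ℤ → A) :=
  {y : ℤ → A | ∀ i : ℤ, ∀ n : ℕ, ∃ x ∈ X, ∃ m : ℕ,
    ∀ j : Fin n, y (i + ((j : ℕ) : ℤ)) = x (m + (j : ℕ))}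

theorem shiftN_iterate_apply {A : Type*} (x : ℕ → A) (n m : ℕ) :
    shiftN^[n] x m = x (m + n) := by
  induction n generalizing m with
  | zero => rfl
  | succ n ih =>
    rw [Function.iterate_succ_apply', shiftN, ih]
    congr 1
    omega

theorem shiftN_iterate_mem {A : Type*} {X : Set (ℕ → A)} (hinv : ∀ x ∈ X, shiftN x ∈ X)
    {x : ℕ → A} (hx : x ∈ X) (n : ℕ) : shiftN^[n] x ∈ X := by
  induction n with
  | zero => exact hx
  | succ n ih =>
    rw [Function.iterate_succ_apply']
    exact hinv _ ih

/-- The right ray of a bi-infinite sequence starting at position `i`. -/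
def rightRay {A : Type*} (y : ℤ → A) (i : ℤ) : ℕ → A := fun n => y (i + n)

theorem shiftN_rightRay {A : Type*} (y : ℤ → A) (i : ℤ) :
    shiftN (rightRay y i) = rightRay y (i + 1) := by
  funext n
  simp only [shiftN, rightRay]
  congr 1
  push_cast
  ring

theorem rightRay_mem {A : Type*} [TopologicalSpace A] [DiscreteTopology A]
    {X : Set (ℕ → A)} (hclosed : IsClosed X) (hinv : ∀ x ∈ X, shiftN x ∈ X)
    {y : ℤ → A} (hy : y ∈ twoSidedVersion X) (i : ℤ) : rightRay y i ∈ X := by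
  choose x hx m hm using hy i
  have htendsto : Filter.Tendsto (fun n => shiftN^[m n] (x n)) Filter.atTop
      (nhds (rightRay y i)) := by
    rw [tendsto_pi_nhds]
    intro k
    refine tendsto_const_nhds.congr' ?_
    filter_upwards [Filter.eventually_gt_atTop k] with n hn
    rw [shiftN_iterate_apply, rightRay, hm n ⟨k, hn⟩, add_comm]
  exact hclosed.mem_of_tendsto htendsto
    (Filter.Eventually.of_forall fun n => shiftN_iterate_mem hinv (hx n) _)

theorem shiftZIter_mem {A : Type*} {X : Set (ℕ → A)} {y : ℤ → A}
    (hy : y ∈ twoSidedVersion X) (k : ℤ) : shiftZIter k y ∈ twoSidedVersion X := by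
  intro i n
  obtain ⟨x, hx, m, hm⟩ := hy (i + k) n
  refine ⟨x, hx, m, fun j => ?_⟩
  rw [← hm j, shiftZIter]
  congr 1
  ring

theorem shiftZIter_shiftZIter {A : Type*} (y : ℤ → A) (k l : ℤ) :
    shiftZIter k (shiftZIter l y) = shiftZIter (k + l) y := by
  funext n
  simp only [shiftZIter]
  congr 1
  ring

theorem orbitZ_shiftZIter {A : Type*} (y : ℤ → A) (k : ℤ) :
    orbitZ (shiftZIter k y) = orbitZ y := by
  ext z
  constructor
  · rintro ⟨n, rfl⟩
    exact ⟨n + k, (shiftZIter_shiftZIter y n k).symm⟩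
  · rintro ⟨n, rfl⟩
    refine ⟨n - k, ?_⟩
    simp only [shiftZIter_shiftZIter, sub_add_cancel]

theorem self_mem_orbitZ {A : Type*} (y : ℤ → A) : y ∈ orbitZ y :=
  ⟨0, by funext n; simp [shiftZIter]⟩

theorem not_periodic_of_minimal {A : Type*} [TopologicalSpace A] [DiscreteTopology A]
    {X : Set (ℕ → A)} (hmin : MinimalN X) (hinf : X.Infinite)
    {x : ℕ → A} (hx : x ∈ X) {p : ℕ} (hp : 0 < p) : ¬ Function.Periodic x p := by
  intro hper
  have hfin : {y : ℕ → A | ∃ n : ℕ, y = shiftN^[n] x}.Finite := by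
    refine ((Set.finite_lt_nat p).image fun n => shiftN^[n] x).subset ?_
    rintro _ ⟨n, rfl⟩
    refine ⟨n % p, Nat.mod_lt _ hp, ?_⟩
    funext k
    simp only [shiftN_iterate_apply]
    rw [← hper.map_mod_nat (k + n % p), ← hper.map_mod_nat (k + n), Nat.add_mod_mod]
  exact hinf (hfin.subset (by simpa [hfin.isClosed.closure_eq] using hmin x hx))

theorem eq_zero_of_eventually_periodic {A : Type*} [TopologicalSpace A] [DiscreteTopology A]
    {X : Set (ℕ → A)} (hclosed : IsClosed X) (hinv : ∀ x ∈ X, shiftN x ∈ X)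
    (hmin : MinimalN X) (hinf : X.Infinite) {y : ℤ → A} (hy : y ∈ twoSidedVersion X)
    {m : ℤ} (hper : RightAsymptotic (shiftZIter m y) y) : m = 0 := by
  obtain ⟨N, hN⟩ := hper
  simp only [shiftZIter] at hN
  rcases lt_trichotomy m 0 with hm | hm | hm
  · refine absurd ?_ (not_periodic_of_minimal hmin hinf (rightRay_mem hclosed hinv hy (N + m))
      (p := m.natAbs) (by omega))
    intro n
    simp only [rightRay]
    rw [show N + m + ((n + m.natAbs : ℕ) : ℤ) = N + n by omega, ← hN (N + n) (by omega)]
    congr 1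
    ring
  · exact hm
  · refine absurd ?_ (not_periodic_of_minimal hmin hinf (rightRay_mem hclosed hinv hy N)
      (p := m.natAbs) (by omega))
    intro n
    simp only [rightRay]
    rw [show N + ((n + m.natAbs : ℕ) : ℤ) = N + n + m by omega, hN (N + n) (by omega)]

theorem exists_preimage_of_minimal {A : Type*} [Finite A] [TopologicalSpace A]
    [DiscreteTopology A] {X : Set (ℕ → A)} (hclosed : IsClosed X)
    (hinv : ∀ x ∈ X, shiftN x ∈ X) (hmin : MinimalN X) {x : ℕ → A} (hx : x ∈ X) :
    ∃ y ∈ X, shiftN y = x := by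
  have hcont : Continuous (shiftN : (ℕ → A) → ℕ → A) :=
    continuous_pi fun n => continuous_apply (n + 1)
  have hclosed' : IsClosed (shiftN '' X) := (hclosed.isCompact.image hcont).isClosed
  refine closure_minimal ?_ hclosed' (hmin _ (hinv x hx) hx)
  rintro _ ⟨n, rfl⟩
  refine ⟨shiftN^[n] x, shiftN_iterate_mem hinv hx n, ?_⟩
  rw [← Function.iterate_succ_apply' shiftN, Function.iterate_succ_apply]

theorem exists_twoSided_extension {A : Type*} [Finite A] [TopologicalSpace A]
    [DiscreteTopology A] {X : Set (ℕ → A)} (hclosed : IsClosed X)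
    (hinv : ∀ x ∈ X, shiftN x ∈ X) (hmin : MinimalN X) {x : ℕ → A} (hx : x ∈ X) :
    ∃ y ∈ twoSidedVersion X, rightRay y 0 = x := by
  choose g hgX hg using fun z : X => exists_preimage_of_minimal hclosed hinv hmin z.2
  let G : X → X := fun z => ⟨g z, hgX z⟩
  let u : ℕ → ℕ → A := fun k => (G^[k] ⟨x, hx⟩ : X)
  have hu (k n : ℕ) : u (k + 1) (n + 1) = u k n := by
    simp only [u, Function.iterate_succ_apply']
    exact congrFun (hg _) n
  have hud (d k n : ℕ) : u (k + d) (n + d) = u k n := by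
    induction d with
    | zero => rfl
    | succ d ih => rw [← ih, ← hu (k + d)]; rfl
  have hy (k n : ℕ) : u (-(-(k : ℤ) + n)).toNat (-(k : ℤ) + n).toNat = u k n := by
    rcases le_total k n with h | h
    · convert (hud k 0 (n - k)).symm using 2 <;> omega
    · convert (hud n (k - n) 0).symm using 2 <;> omega
  refine ⟨fun n => u (-n).toNat n.toNat, fun i n => ?_, ?_⟩
  · refine ⟨u (-i).toNat, Subtype.coe_prop _, i.toNat, fun j => ?_⟩
    rw [← hy]
    have h : i + ((j : ℕ) : ℤ) = -((-i).toNat : ℤ) + ((i.toNat + j : ℕ) : ℤ) := by omega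
    simp only [h]
  · funext n
    simp [rightRay, u]

theorem finite_RA_orbits_of_finite_branch_points {A : Type*} [Finite A] [TopologicalSpace A]
    [DiscreteTopology A] {X : Set (ℕ → A)} (hclosed : IsClosed X)
    (hinv : ∀ x ∈ X, shiftN x ∈ X) (hmin : MinimalN X) (hinf : X.Infinite)
    (hfin : {x : ℕ → A | IsBranchPoint X x}.Finite) :
    {O : Set (ℤ → A) | IsRAOrbit (twoSidedVersion X) O}.Finite := by
  -- Each right asymptotic orbit has a representative whose leftmost branching ray starts at `0`.
  let S : Set (ℤ → A) := {y | y ∈ twoSidedVersion X ∧ IsBranchPoint X (rightRay y 0) ∧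
    ∀ j < 0, ¬ IsBranchPoint X (rightRay y j)}
  have hS : S.Finite := by
    refine Set.Finite.of_finite_image (f := fun y => (rightRay y 0, y (-1)))
      ((hfin.prod Set.finite_univ).subset ?_) ?_
    · rintro _ ⟨y, hy, rfl⟩
      exact ⟨hy.2.1, trivial⟩
    · rintro y ⟨hyX, -, hyb⟩ z ⟨hzX, -, -⟩ hyz
      simp only [Prod.mk.injEq] at hyz
      have hray (k : ℕ) : rightRay y (-1 - k) = rightRay z (-1 - k) := by
        induction k with
        | zero =>
          funext n
          cases n with
          | zero => simpa [rightRay] using hyz.2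
          | succ n =>
            have := congrFun hyz.1 n
            simpa [rightRay] using this
        | succ k ih =>
          by_contra hne
          refine hyb (-1 - k) (by omega) ⟨rightRay_mem hclosed hinv hyX _,
            _, rightRay_mem hclosed hinv hyX _, _, rightRay_mem hclosed hinv hzX _, hne, ?_, ?_⟩
          · rw [shiftN_rightRay]
            congr 1
            push_cast
            ring
          · rw [shiftN_rightRay, ih]
            congr 1
            push_cast
            ring
      funext i
      have := congrFun (hray (-i).toNat) (i + 1 + (-i).toNat).toNat
      simp only [rightRay] at this
      rwa [show -1 - ((-i).toNat : ℤ) + ((i + 1 + (-i).toNat).toNat : ℤ) = i by omega] at this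
  refine (hS.image orbitZ).subset ?_
  rintro _ ⟨⟨x, hx, rfl⟩, y, hy, hdisj, p, hp, q, hq, N, hN⟩
  have hpq : p ≠ q := by
    rintro rfl
    exact Set.eq_empty_iff_forall_notMem.mp hdisj p ⟨hp, hq⟩
  obtain ⟨kp, rfl⟩ := hp
  obtain ⟨kq, rfl⟩ := hq
  have hpX := shiftZIter_mem hx kp
  have hqX := shiftZIter_mem hy kq
  simp only at hN hpq
  rw [← orbitZ_shiftZIter x kp]
  generalize shiftZIter kp x = p at *
  generalize shiftZIter kq y = q at *
  obtain ⟨i₀, hi₀⟩ := Function.ne_iff.mp hpq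
  obtain ⟨k, hk, hkmax⟩ := Int.exists_greatest_of_bdd (P := fun i => p i ≠ q i)
    ⟨N, fun i hi => not_lt.mp fun h => hi (hN i h.le)⟩ ⟨i₀, hi₀⟩
  have hbranch : IsBranchPoint X (rightRay p (k + 1)) := by
    refine ⟨rightRay_mem hclosed hinv hpX _, rightRay p k, rightRay_mem hclosed hinv hpX _,
      rightRay q k, rightRay_mem hclosed hinv hqX _, ?_, shiftN_rightRay p k, ?_⟩
    · intro h
      exact hk (by simpa [rightRay] using congrFun h 0)
    · rw [shiftN_rightRay]
      funext n
      by_contra h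
      have := hkmax (k + 1 + n) (Ne.symm h)
      omega
  have hinj : Function.Injective (rightRay p) := by
    intro i j hij
    have : j - i = 0 := eq_zero_of_eventually_periodic hclosed hinv hmin hinf hpX
      ⟨i, fun n hn => by
        have := congrFun hij (n - i).toNat
        simp only [rightRay] at this
        rw [shiftZIter]
        convert this.symm using 2 <;> omega⟩
    omega
  have hfinpos : {i : ℤ | IsBranchPoint X (rightRay p i)}.Finite :=
    hfin.preimage hinj.injOn
  obtain ⟨b, hb⟩ := hfinpos.bddBelow
  obtain ⟨l, hl, hlmin⟩ := Int.exists_least_of_bdd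
    (P := fun i => IsBranchPoint X (rightRay p i)) ⟨b, fun i hi => hb hi⟩ ⟨_, hbranch⟩
  have hshift (j : ℤ) : rightRay (shiftZIter l p) j = rightRay p (j + l) := by
    funext n
    simp only [rightRay, shiftZIter]
    congr 1
    ring
  refine ⟨shiftZIter l p, ⟨shiftZIter_mem hpX l, by rwa [hshift, zero_add], fun j hj h => ?_⟩,
    orbitZ_shiftZIter p l⟩
  rw [hshift] at h
  have := hlmin _ h
  omega

theorem isRAOrbit_of_rightAsymptotic_of_ne {A : Type*} [TopologicalSpace A] [DiscreteTopology A]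
    {X : Set (ℕ → A)} (hclosed : IsClosed X) (hinv : ∀ x ∈ X, shiftN x ∈ X)
    (hmin : MinimalN X) (hinf : X.Infinite) {y z : ℤ → A} (hy : y ∈ twoSidedVersion X)
    (hz : z ∈ twoSidedVersion X) (hne : y ≠ z) (hyz : RightAsymptotic y z) :
    IsRAOrbit (twoSidedVersion X) (orbitZ y) := by
  refine ⟨⟨y, hy, rfl⟩, z, hz, ?_, y, self_mem_orbitZ y, z, self_mem_orbitZ z, hyz⟩
  rw [Set.eq_empty_iff_forall_notMem]
  rintro _ ⟨⟨k, rfl⟩, l, hl⟩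
  have hzy : shiftZIter (l - k) z = y := by
    have := congrArg (shiftZIter (-k)) hl
    simp only [shiftZIter_shiftZIter] at this
    rw [sub_eq_neg_add, this]
    funext n
    simp [shiftZIter]
  have h0 : l - k = 0 :=
    eq_zero_of_eventually_periodic hclosed hinv hmin hinf hz (by rwa [hzy])
  apply hne
  rw [← hzy, h0]
  funext n
  simp [shiftZIter]

theorem finite_branch_points_of_finite_RA_orbits {A : Type*} [Finite A] [TopologicalSpace A]
    [DiscreteTopology A] {X : Set (ℕ → A)} (hclosed : IsClosed X)
    (hinv : ∀ x ∈ X, shiftN x ∈ X) (hmin : MinimalN X) (hinf : X.Infinite)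
    (hfin : {O : Set (ℤ → A) | IsRAOrbit (twoSidedVersion X) O}.Finite) :
    {x : ℕ → A | IsBranchPoint X x}.Finite := by
  have hext (x : {x : ℕ → A | IsBranchPoint X x}) : ∃ y ∈ twoSidedVersion X,
      ∃ z ∈ twoSidedVersion X, y 0 ≠ z 0 ∧ rightRay y 1 = x ∧ rightRay z 1 = x := by
    obtain ⟨x, -, y', hy', z', hz', hne, hyx, hzx⟩ := x
    obtain ⟨y, hy, rfl⟩ := exists_twoSided_extension hclosed hinv hmin hy'
    obtain ⟨z, hz, rfl⟩ := exists_twoSided_extension hclosed hinv hmin hz'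
    have hray (w : ℤ → A) : shiftN (rightRay w 0) = rightRay w 1 := shiftN_rightRay w 0
    rw [hray] at hyx hzx
    refine ⟨y, hy, z, hz, fun h0 => hne ?_, hyx, hzx⟩
    funext n
    cases n with
    | zero => simpa [rightRay] using h0
    | succ n =>
      have := congrFun (hyx.trans hzx.symm) n
      simpa [rightRay, add_comm] using this
  choose y hy z hz hne hyx hzx using hext
  have heq (x) (n : ℤ) (hn : 1 ≤ n) : y x n = z x n := by
    have := congrFun ((hyx x).trans (hzx x).symm) (n - 1).toNat
    simp only [rightRay] at this
    rwa [show 1 + ((n - 1).toNat : ℤ) = n by omega] at this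
  have hRAy (x) : IsRAOrbit (twoSidedVersion X) (orbitZ (y x)) :=
    isRAOrbit_of_rightAsymptotic_of_ne hclosed hinv hmin hinf (hy x) (hz x)
      (fun h => hne x (congrFun h 0)) ⟨1, heq x⟩
  have hRAz (x) : IsRAOrbit (twoSidedVersion X) (orbitZ (z x)) :=
    isRAOrbit_of_rightAsymptotic_of_ne hclosed hinv hmin hinf (hz x) (hy x)
      (fun h => hne x (congrFun h 0).symm) ⟨1, fun n hn => (heq x n hn).symm⟩
  have : Finite {O : Set (ℤ → A) | IsRAOrbit (twoSidedVersion X) O} := hfin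
  let F : {x : ℕ → A | IsBranchPoint X x} →
      {O : Set (ℤ → A) | IsRAOrbit (twoSidedVersion X) O} ×
        {O : Set (ℤ → A) | IsRAOrbit (twoSidedVersion X) O} :=
    fun x => (⟨orbitZ (y x), hRAy x⟩, ⟨orbitZ (z x), hRAz x⟩)
  refine Set.finite_coe_iff.mp (Finite.of_injective F fun a b hab => ?_)
  simp only [F, Prod.mk.injEq, Subtype.mk.injEq] at hab
  obtain ⟨k, hk⟩ : y b ∈ orbitZ (y a) := hab.1 ▸ self_mem_orbitZ (y b)
  obtain ⟨l, hl⟩ : z b ∈ orbitZ (z a) := hab.2 ▸ self_mem_orbitZ (z b)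
  simp only at hk hl
  have hkb (n : ℤ) : y a (n + k) = y b n := congrFun hk n
  have hlb (n : ℤ) : z a (n + l) = z b n := congrFun hl n
  have hkl : k - l = 0 := by
    refine eq_zero_of_eventually_periodic hclosed hinv hmin hinf (hy a)
      ⟨max 1 (1 + l), fun n hn => ?_⟩
    rw [shiftZIter, show n + (k - l) = n - l + k by ring, hkb, heq b _ (by omega), ← hlb,
      sub_add_cancel, heq a _ (by omega)]
  obtain rfl : k = l := by omega
  have hk0 : k = 0 := by
    rcases lt_trichotomy k 0 with h | h | h
    · refine absurd ?_ (hne a)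
      have h1 := hkb (-k)
      have h2 := hlb (-k)
      rw [neg_add_cancel] at h1 h2
      rw [h1, h2, heq b _ (by omega)]
    · exact h
    · refine absurd ?_ (hne b)
      rw [← hkb, ← hlb, heq a _ (by omega)]
  subst hk0
  apply Subtype.ext
  rw [← hyx a, ← hyx b]
  funext n
  simpa [rightRay] using hkb (1 + n)

/-- An infinite minimal one-sided shift `X` has finitely many branch
points iff its two-sided version has finitely many right asymptotic orbits. -/
theorem finite_branch_points_iff_finite_RA_orbits
    {A : Type*} [Fintype A] [TopologicalSpace A] [DiscreteTopology A]
    (X : Set (ℕ → A)) (hne : X.Nonempty) (hclosed : IsClosed X)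
    (hinv : ∀ x ∈ X, shiftN x ∈ X)
    (hmin : MinimalN X) (hinf : X.Infinite) :
    {x : ℕ → A | IsBranchPoint X x}.Finite ↔
      {O : Set (ℤ → A) | IsRAOrbit (twoSidedVersion X) O}.Finite := by
  exact ⟨finite_RA_orbits_of_finite_branch_points hclosed hinv hmin hinf,
    finite_branch_points_of_finite_RA_orbits hclosed hinv hmin hinf⟩
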